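/- Fix t ∈ (0,1) and set ρ = (1 − √(1−t²)) / (2√(1−t²)). For every ε > 0 there exists N such that for all n ≥ N, every finite set C of unit vectors in ℝ^n satisfying ⟨x,y⟩ ≤ t for all distinct x, y ∈ C satisfies (1/n)·log₂|C| ≤ (1+ρ)·log₂(1+ρ) − ρ·log₂ρ + ε. -/

import Mathlib

namespace ZonalHarmonic

open MvPolynomial

section Fischer

variable {σ : Type*}

/-- The Fischer pairing `⟨p, q⟩ = ∑ₘ m! pₘ qₘ`, as a linear functional of `p`. -/
noncomputable def fischer (q : MvPolynomial σ ℝ) : MvPolynomial σ ℝ →ₗ[ℝ] ℝ :=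
  (basisMonomials σ ℝ).constr ℝ fun m => (m.prod fun _ k => (k.factorial : ℝ)) * coeff m q

theorem fischer_monomial (q : MvPolynomial σ ℝ) (m : σ →₀ ℕ) (a : ℝ) :
    fischer q (monomial m a) = a * ((m.prod fun _ k => (k.factorial : ℝ)) * coeff m q) := by
  have h : (monomial m a : MvPolynomial σ ℝ) = a • basisMonomials σ ℝ m := by
    simp [smul_monomial]
  rw [h, map_smul, fischer, Module.Basis.constr_basis, smul_eq_mul]

theorem prod_factorial_add_single (m : σ →₀ ℕ) (j : σ) :
    ((m + Finsupp.single j 1).prod fun _ k => (k.factorial : ℝ)) =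
      (m j + 1) * m.prod fun _ k => (k.factorial : ℝ) := by
  classical
  have hs : m.support ⊆ insert j m.support := Finset.subset_insert _ _
  have hs' : (m + Finsupp.single j 1).support ⊆ insert j m.support := by
    intro i hi
    by_cases hij : i = j
    · simp [hij]
    · simpa [Finsupp.single_apply, hij, Ne.symm hij] using hi
  rw [Finsupp.prod_of_support_subset _ hs' _ (by simp),
    Finsupp.prod_of_support_subset _ hs _ (by simp),
    ← Finset.mul_prod_erase _ _ (Finset.mem_insert_self j _),
    ← Finset.mul_prod_erase _ (fun i => ((m i).factorial : ℝ)) (Finset.mem_insert_self j _),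
    ← mul_assoc]
  congr 1
  · simp [Nat.factorial_succ]
  · refine Finset.prod_congr rfl fun i hi => ?_
    have : j ≠ i := (Finset.ne_of_mem_erase hi).symm
    simp [this]

theorem fischer_X_mul (j : σ) (p q : MvPolynomial σ ℝ) :
    fischer q (X j * p) = fischer (pderiv j q) p := by
  induction p using MvPolynomial.induction_on' with
  | add p p' hp hp' => rw [mul_add, map_add, map_add, hp, hp']
  | monomial m a =>
    have h : X j * monomial m a = monomial (m + Finsupp.single j 1) a := by
      rw [X, monomial_mul, one_mul, add_comm]
    rw [h, fischer_monomial, fischer_monomial, coeff_pderiv, prod_factorial_add_single]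
    ring

theorem fischer_eq_sum {p : MvPolynomial σ ℝ} {s : Finset (σ →₀ ℕ)} (hs : p.support ⊆ s)
    (q : MvPolynomial σ ℝ) :
    fischer q p =
      ∑ m ∈ s, (m.prod fun _ k => (k.factorial : ℝ)) * (coeff m p * coeff m q) := by
  conv_lhs => rw [p.as_sum, map_sum]
  refine (Finset.sum_subset hs fun m _ hm => ?_).trans (Finset.sum_congr rfl fun m _ => ?_)
  · rw [fischer_monomial, notMem_support_iff.mp hm, zero_mul]
  · rw [fischer_monomial]
    ring

theorem fischer_comm (p q : MvPolynomial σ ℝ) : fischer p q = fischer q p := by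
  classical
  rw [fischer_eq_sum (Finset.subset_union_left (s₂ := p.support)),
    fischer_eq_sum (Finset.subset_union_right (s₁ := q.support))]
  exact Finset.sum_congr rfl fun m _ => by ring

end Fischer

section Operators

theorem pderiv_comm {σ : Type*} (j k : σ) (p : MvPolynomial σ ℝ) :
    pderiv j (pderiv k p) = pderiv k (pderiv j p) := by
  classical
  ext m
  simp only [coeff_pderiv, Finsupp.add_apply, Finsupp.single_apply, add_right_comm m]
  by_cases h : j = k
  · simp [h]
  · simp only [h, Ne.symm h, if_false]
    push_cast
    ring

variable {σ : Type*} [Fintype σ]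

/-- The linear form `∑ⱼ xⱼ Xⱼ`. -/
noncomputable def lin (x : σ → ℝ) : MvPolynomial σ ℝ := ∑ j, C (x j) * X j

/-- The quadratic form `∑ⱼ Xⱼ²`. -/
noncomputable def rsq : MvPolynomial σ ℝ := ∑ j, X j * X j

/-- The derivative of a polynomial in the direction `x`. -/
noncomputable def dirDeriv (x : σ → ℝ) (p : MvPolynomial σ ℝ) : MvPolynomial σ ℝ :=
  ∑ j, C (x j) * pderiv j p

/-- The Laplacian of a polynomial. -/
noncomputable def lap (p : MvPolynomial σ ℝ) : MvPolynomial σ ℝ := ∑ j, pderiv j (pderiv j p)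

theorem pderiv_lin (x : σ → ℝ) (j : σ) : pderiv j (lin x) = C (x j) := by
  classical
  simp [lin, pderiv_X, Pi.single_apply]

theorem pderiv_rsq (j : σ) : pderiv j (rsq : MvPolynomial σ ℝ) = 2 * X j := by
  classical
  simp [rsq, pderiv_X, Pi.single_apply, Finset.sum_add_distrib, two_mul]

theorem dirDeriv_mul (x : σ → ℝ) (p q : MvPolynomial σ ℝ) :
    dirDeriv x (p * q) = dirDeriv x p * q + p * dirDeriv x q := by
  simp only [dirDeriv, pderiv_mul, Finset.sum_mul, Finset.mul_sum, ← Finset.sum_add_distrib]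
  exact Finset.sum_congr rfl fun j _ => by ring

theorem dirDeriv_sub (x : σ → ℝ) (p q : MvPolynomial σ ℝ) :
    dirDeriv x (p - q) = dirDeriv x p - dirDeriv x q := by
  simp only [dirDeriv, map_sub, mul_sub, Finset.sum_sub_distrib]

theorem dirDeriv_C (x : σ → ℝ) (a : ℝ) : dirDeriv x (C a) = 0 := by
  simp [dirDeriv]

theorem dirDeriv_lin (x y : σ → ℝ) : dirDeriv x (lin y) = C (∑ j, x j * y j) := by
  simp [dirDeriv, pderiv_lin]

theorem dirDeriv_rsq (x : σ → ℝ) : dirDeriv x rsq = 2 * lin x := by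
  simp only [dirDeriv, pderiv_rsq, lin, Finset.mul_sum]
  exact Finset.sum_congr rfl fun j _ => by ring

theorem lap_sub (p q : MvPolynomial σ ℝ) : lap (p - q) = lap p - lap q := by
  simp only [lap, map_sub, Finset.sum_sub_distrib]

theorem lap_C_mul (a : ℝ) (p : MvPolynomial σ ℝ) : lap (C a * p) = C a * lap p := by
  simp only [lap, pderiv_C_mul, Finset.mul_sum]

theorem lap_lin_mul (x : σ → ℝ) (p : MvPolynomial σ ℝ) :
    lap (lin x * p) = lin x * lap p + 2 * dirDeriv x p := by
  simp only [lap, dirDeriv, Finset.mul_sum, ← Finset.sum_add_distrib, pderiv_mul, pderiv_lin,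
    map_add, pderiv_C]
  exact Finset.sum_congr rfl fun j _ => by ring

theorem lap_rsq_mul {p : MvPolynomial σ ℝ} {i : ℕ} (hp : p.IsHomogeneous i) :
    lap (rsq * p) = rsq * lap p + ((2 * Fintype.card σ + 4 * i : ℕ) : MvPolynomial σ ℝ) * p := by
  have h : ∀ j, pderiv j (pderiv j (rsq * p)) =
      rsq * pderiv j (pderiv j p) + 4 * (X j * pderiv j p) + 2 * p := fun j => by
    have h2 : pderiv j (2 : MvPolynomial σ ℝ) = 0 := by
      rw [← map_ofNat (C : ℝ →+* MvPolynomial σ ℝ) 2, pderiv_C]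
    simp only [pderiv_mul, pderiv_rsq, map_add, pderiv_X_self, h2]
    ring
  simp only [lap, h, Finset.sum_add_distrib, ← Finset.mul_sum, hp.sum_X_mul_pderiv]
  simp only [Finset.sum_const, Finset.card_univ, nsmul_eq_mul]
  push_cast
  ring

theorem lap_dirDeriv (x : σ → ℝ) (p : MvPolynomial σ ℝ) :
    lap (dirDeriv x p) = dirDeriv x (lap p) := by
  simp only [lap, dirDeriv, map_sum, pderiv_C_mul, Finset.mul_sum]
  rw [Finset.sum_comm]
  refine Finset.sum_congr rfl fun j _ => Finset.sum_congr rfl fun k _ => ?_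
  rw [pderiv_comm k j, pderiv_comm k j]

theorem isHomogeneous_lin (x : σ → ℝ) : (lin x).IsHomogeneous 1 :=
  .sum _ _ _ fun j _ => isHomogeneous_C_mul_X _ j

theorem isHomogeneous_rsq : (rsq : MvPolynomial σ ℝ).IsHomogeneous 2 :=
  .sum _ _ _ fun j _ => (isHomogeneous_X _ j).mul (isHomogeneous_X _ j)

theorem isHomogeneous_dirDeriv (x : σ → ℝ) {p : MvPolynomial σ ℝ} {i : ℕ}
    (hp : p.IsHomogeneous i) : (dirDeriv x p).IsHomogeneous (i - 1) :=
  .sum _ _ _ fun _ _ => hp.pderiv.C_mul _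

theorem eval_dirDeriv (x : σ → ℝ) {p : MvPolynomial σ ℝ} {i : ℕ} (hp : p.IsHomogeneous i) :
    eval x (dirDeriv x p) = i * eval x p := by
  have := congrArg (eval x) hp.sum_X_mul_pderiv
  simpa [dirDeriv] using this

theorem fischer_lin_mul (x : σ → ℝ) (p q : MvPolynomial σ ℝ) :
    fischer q (lin x * p) = fischer (dirDeriv x q) p := by
  rw [← fischer_comm p, dirDeriv, map_sum, lin, Finset.sum_mul, map_sum]
  refine Finset.sum_congr rfl fun j _ => ?_
  rw [mul_assoc, C_mul', C_mul', map_smul, map_smul, fischer_X_mul, fischer_comm p]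

theorem fischer_rsq_mul {q : MvPolynomial σ ℝ} (hq : lap q = 0) (p : MvPolynomial σ ℝ) :
    fischer q (rsq * p) = 0 := by
  have : fischer q (rsq * p) = fischer p (lap q) := by
    rw [lap, map_sum, rsq, Finset.sum_mul, map_sum]
    refine Finset.sum_congr rfl fun j _ => ?_
    rw [mul_assoc, fischer_X_mul, fischer_X_mul, fischer_comm p]
  rw [this, hq, map_zero]

end Operators

section Zonal

variable {n : ℕ}

/-- The Gegenbauer polynomials of the sphere in `ℝⁿ`, normalized to be `1` at `1`. -/
noncomputable def gegenbauer (n : ℕ) : ℕ → ℝ → ℝ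
  | 0, _ => 1
  | 1, s => s
  | i + 2, s => (2 * i + n) / (i + n - 1) * (s * gegenbauer n (i + 1) s) -
      (i + 1) / (i + n - 1) * gegenbauer n i s

/-- The zonal harmonics, as homogeneous polynomials. -/
noncomputable def zonal (x : Fin n → ℝ) : ℕ → MvPolynomial (Fin n) ℝ
  | 0 => 1
  | 1 => lin x
  | i + 2 => C ((2 * i + n : ℝ) / (i + n - 1)) * (lin x * zonal x (i + 1)) -
      C ((i + 1 : ℝ) / (i + n - 1)) * (rsq * zonal x i)

theorem add_sub_one_pos (hn : 2 ≤ n) (i : ℕ) : (0 : ℝ) < i + n - 1 := by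
  have : (2 : ℝ) ≤ n := by exact_mod_cast hn
  have : (0 : ℝ) ≤ i := by positivity
  linarith

theorem zonal_rec (hn : 2 ≤ n) (x : Fin n → ℝ) (i : ℕ) :
    C (i + n - 1 : ℝ) * zonal x (i + 2) =
      C (2 * i + n : ℝ) * (lin x * zonal x (i + 1)) - C (i + 1 : ℝ) * (rsq * zonal x i) := by
  have h := (add_sub_one_pos hn i).ne'
  rw [zonal, mul_sub, ← mul_assoc, ← mul_assoc (C _) (C _) (rsq * _), ← C_mul, ← C_mul,
    mul_div_cancel₀ _ h, mul_div_cancel₀ _ h]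

theorem isHomogeneous_zonal (x : Fin n → ℝ) : ∀ i, (zonal x i).IsHomogeneous i
  | 0 => isHomogeneous_one _ _
  | 1 => isHomogeneous_lin x
  | i + 2 => by
    rw [zonal]
    refine .sub (.C_mul ?_ _) (.C_mul ?_ _)
    · simpa [add_comm, add_left_comm] using
        (isHomogeneous_lin x).mul (isHomogeneous_zonal x (i + 1))
    · simpa [add_comm] using isHomogeneous_rsq.mul (isHomogeneous_zonal x i)

theorem dirDeriv_zonal (hn : 2 ≤ n) {x : Fin n → ℝ} (hx : ∑ j, x j * x j = 1) :
    ∀ i, dirDeriv x (zonal x (i + 1)) = C (i + 1 : ℝ) * zonal x i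
  | 0 => by simp [zonal, dirDeriv_lin, hx]
  | 1 => by
    have h0 : (C (0 + n - 1 : ℝ) : MvPolynomial (Fin n) ℝ) ≠ 0 :=
      C_ne_zero.mpr (by simpa using (add_sub_one_pos hn 0).ne')
    refine mul_left_cancel₀ h0 ?_
    have h := congrArg (dirDeriv x) (zonal_rec hn x 0)
    simp only [dirDeriv_sub, dirDeriv_mul, dirDeriv_C, dirDeriv_rsq, dirDeriv_lin, hx, zonal,
      ← C_1, Nat.cast_zero, zero_add, Nat.cast_one] at h ⊢
    simp only [map_add, map_sub, map_mul, map_one, map_natCast, map_ofNat, map_zero] at h ⊢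
    linear_combination h
  | i + 2 => by
    have h0 : (C ((i + 1 : ℕ) + n - 1 : ℝ) : MvPolynomial (Fin n) ℝ) ≠ 0 :=
      C_ne_zero.mpr (add_sub_one_pos hn (i + 1)).ne'
    refine mul_left_cancel₀ h0 ?_
    have h := congrArg (dirDeriv x) (zonal_rec hn x (i + 1))
    have h1 := zonal_rec hn x i
    simp only [dirDeriv_sub, dirDeriv_mul, dirDeriv_C, dirDeriv_rsq, dirDeriv_lin, hx,
      dirDeriv_zonal hn hx (i + 1), dirDeriv_zonal hn hx i] at h
    simp only [map_add, map_sub, map_mul, map_one, map_natCast, map_ofNat, Nat.cast_add,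
      Nat.cast_one, Nat.cast_ofNat] at h h1 ⊢
    linear_combination h - ((i : MvPolynomial (Fin n) ℝ) + 2) * h1

theorem lap_zonal (hn : 2 ≤ n) {x : Fin n → ℝ} (hx : ∑ j, x j * x j = 1) :
    ∀ i, lap (zonal x i) = 0
  | 0 => by simp [zonal, lap]
  | 1 => by simp [zonal, lap, pderiv_lin]
  | i + 2 => by
    have h0 : (C (i + n - 1 : ℝ) : MvPolynomial (Fin n) ℝ) ≠ 0 :=
      C_ne_zero.mpr (add_sub_one_pos hn i).ne'
    refine mul_left_cancel₀ h0 ?_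
    rw [← lap_C_mul, zonal_rec hn, lap_sub, lap_C_mul, lap_C_mul, lap_lin_mul,
      lap_rsq_mul (isHomogeneous_zonal x i), lap_zonal hn hx (i + 1), lap_zonal hn hx i,
      dirDeriv_zonal hn hx]
    simp only [map_add, map_mul, map_one, map_natCast, map_ofNat, Fintype.card_fin]
    push_cast
    ring

theorem eval_zonal {x y : Fin n → ℝ} (hy : ∑ j, y j * y j = 1) :
    ∀ i, eval y (zonal x i) = gegenbauer n i (∑ j, x j * y j)
  | 0 => by simp [zonal, gegenbauer]
  | 1 => by simp [zonal, gegenbauer, lin]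
  | i + 2 => by
    simp [zonal, gegenbauer, eval_zonal hy (i + 1), eval_zonal hy i, lin, rsq, hy]

/-- The zonal harmonics are reproducing for harmonic polynomials, up to a factor. -/
theorem exists_fischer_zonal (hn : 2 ≤ n) (i : ℕ) :
    ∃ κ : ℝ, 0 < κ ∧ ∀ (x : Fin n → ℝ) (q : MvPolynomial (Fin n) ℝ), q.IsHomogeneous i →
      lap q = 0 → fischer q (zonal x i) = κ * eval x q := by
  induction i using Nat.strong_induction_on with
  | _ i ih =>
  match i with
  | 0 =>
    refine ⟨1, one_pos, fun x q hq _ => ?_⟩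
    rw [zonal, ← C_1, C_apply, fischer_monomial]
    rw [← totalDegree_zero_iff_isHomogeneous, totalDegree_eq_zero_iff_eq_C] at hq
    rw [hq]
    simp
  | 1 =>
    refine ⟨1, one_pos, fun x q hq _ => ?_⟩
    have h := isHomogeneous_dirDeriv x hq
    have h2 := eval_dirDeriv x hq
    rw [← totalDegree_zero_iff_isHomogeneous, totalDegree_eq_zero_iff_eq_C] at h
    rw [zonal, ← mul_one (lin x), fischer_lin_mul, ← C_1, C_apply, fischer_monomial]
    rw [h] at h2
    simpa using h2
  | i + 2 =>
    obtain ⟨κ, hκ, h⟩ := ih (i + 1) (by omega)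
    have h0 := add_sub_one_pos hn i
    refine ⟨(2 * i + n) / (i + n - 1) * (κ * (i + 2)), ?_, fun x q hq hl => ?_⟩
    · have : (0 : ℝ) < n := by exact_mod_cast (by omega : 0 < n)
      positivity
    rw [zonal, map_sub, C_mul', C_mul', map_smul, map_smul, fischer_lin_mul,
      fischer_rsq_mul hl, h x _ (isHomogeneous_dirDeriv x hq), eval_dirDeriv x hq]
    · simp only [smul_eq_mul, mul_zero, sub_zero]
      push_cast
      ring
    · rw [lap_dirDeriv, hl]
      simp [dirDeriv]

/-- Schoenberg's theorem: Gegenbauer polynomials are positive definite on the sphere, with features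
indexed by monomials. -/
theorem exists_gegenbauer_eq_sum (hn : 2 ≤ n) (i : ℕ) :
    ∃ w : (Fin n → ℝ) → (Fin n →₀ ℕ) → ℝ, ∀ x y : Fin n → ℝ,
      ∑ j, x j * x j = 1 → ∑ j, y j * y j = 1 →
      gegenbauer n i (∑ j, x j * y j) =
        ∑ m ∈ Finset.univ.finsuppAntidiag i, w x m * w y m := by
  obtain ⟨κ, hκ, h⟩ := exists_fischer_zonal hn i
  refine ⟨fun x m => √((m.prod fun _ k => (k.factorial : ℝ)) / κ) * coeff m (zonal x i),
    fun x y hx hy => ?_⟩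
  have hsupp : (zonal y i).support ⊆ Finset.univ.finsuppAntidiag i := fun m hm => by
    have := isHomogeneous_zonal y i (mem_support_iff.mp hm)
    simpa [Finset.mem_finsuppAntidiag, Finsupp.weight_apply, Finsupp.sum_fintype] using this
  have h1 := h y (zonal x i) (isHomogeneous_zonal x i) (lap_zonal hn hx i)
  rw [fischer_eq_sum hsupp, eval_zonal hy] at h1
  rw [← mul_div_cancel_left₀ (gegenbauer n i _) hκ.ne', ← h1, Finset.sum_div]
  refine Finset.sum_congr rfl fun m _ => ?_
  have h2 : 0 ≤ (m.prod fun _ k => (k.factorial : ℝ)) / κ :=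
    div_nonneg (Finset.prod_nonneg fun _ _ => by positivity) hκ.le
  linear_combination -(coeff m (zonal x i) * coeff m (zonal y i)) * Real.mul_self_sqrt h2

end Zonal

end ZonalHarmonic

namespace SphericalCode

open ZonalHarmonic Finset

theorem sum_gram_mul_gram_eq {α ι κ : Type*} (C : Finset α) (S : Finset ι) (T : Finset κ)
    (u : ι → α → ℝ) (v : κ → α → ℝ) :
    ∑ x ∈ C, ∑ y ∈ C, (∑ a ∈ S, u a x * u a y) * (∑ b ∈ T, v b x * v b y) =
      ∑ a ∈ S, ∑ b ∈ T, (∑ x ∈ C, u a x * v b x) ^ 2 := by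
  simp only [sq, sum_mul_sum]
  calc _ = ∑ x ∈ C, ∑ a ∈ S, ∑ y ∈ C, ∑ b ∈ T, u a x * u a y * (v b x * v b y) :=
        sum_congr rfl fun x _ => sum_comm
    _ = ∑ a ∈ S, ∑ x ∈ C, ∑ b ∈ T, ∑ y ∈ C, u a x * u a y * (v b x * v b y) := by
        rw [sum_comm]
        exact sum_congr rfl fun a _ => sum_congr rfl fun x _ => sum_comm
    _ = _ := by
        refine sum_congr rfl fun a _ => ?_
        rw [sum_comm]
        exact sum_congr rfl fun b _ => sum_congr rfl fun x _ => sum_congr rfl fun y _ => by ring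

/-- A Gram matrix with features indexed by `S` has rank at most `#S`, so that
`(tr G)² ≤ #S * tr (G²)`. -/
theorem sq_trace_gram_le {α ι : Type*} (C : Finset α) (S : Finset ι) (u : ι → α → ℝ) :
    (∑ x ∈ C, ∑ a ∈ S, u a x * u a x) ^ 2 ≤
      #S * ∑ x ∈ C, ∑ y ∈ C, (∑ a ∈ S, u a x * u a y) ^ 2 := by
  simp only [sq (∑ a ∈ S, u a _ * u a _), sum_gram_mul_gram_eq]
  rw [sum_comm]
  refine sq_sum_le_card_mul_sum_sq.trans ?_
  gcongr with a ha
  exact single_le_sum (f := fun b => (∑ x ∈ C, u a x * u b x) ^ 2)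
    (fun b _ => sq_nonneg _) ha

/-- Delsarte's bound for a polynomial of the form `(s - t) * K ^ 2`, where `K` is a Gram matrix
with constant diagonal. -/
theorem card_mul_le_of_gram {α ι : Type*} {C : Finset α} {S : Finset ι} {K : α → α → ℝ}
    {t μ κ : ℝ} (hκ : 0 < κ) (s : α → α → ℝ) (u : ι → α → ℝ) (ht : t ≤ 1) (hμ : t ≤ μ)
    (hKu : ∀ x ∈ C, ∀ y ∈ C, K x y = ∑ a ∈ S, u a x * u a y) (hKself : ∀ x ∈ C, K x x = κ)
    (hself : ∀ x ∈ C, s x x ≤ 1) (hst : ∀ x ∈ C, ∀ y ∈ C, x ≠ y → s x y ≤ t)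
    (hlow : μ * ∑ x ∈ C, ∑ y ∈ C, K x y ^ 2 ≤ ∑ x ∈ C, ∑ y ∈ C, s x y * K x y ^ 2) :
    (#C : ℝ) * (μ - t) ≤ #S * (1 - t) := by
  classical
  have hup : ∑ x ∈ C, ∑ y ∈ C, (s x y - t) * K x y ^ 2 ≤ #C * ((1 - t) * κ ^ 2) := by
    rw [← nsmul_eq_mul, ← sum_const]
    refine sum_le_sum fun x hx => ?_
    rw [← add_sum_erase _ _ hx, hKself x hx]
    refine (add_le_of_nonpos_right (sum_nonpos fun y hy => ?_)).trans
      (mul_le_mul_of_nonneg_right (sub_le_sub_right (hself x hx) t) (sq_nonneg κ))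
    rw [mem_erase] at hy
    exact mul_nonpos_of_nonpos_of_nonneg (sub_nonpos.mpr (hst x hx y hy.2 hy.1.symm))
      (sq_nonneg _)
  have htr := sq_trace_gram_le C S u
  rw [sum_congr rfl fun x hx => (hKu x hx x hx).symm.trans (hKself x hx), sum_const,
    nsmul_eq_mul, ← sum_congr rfl fun x hx => sum_congr rfl fun y hy =>
      congrArg (· ^ 2) (hKu x hx y hy)] at htr
  simp only [sub_mul, sum_sub_distrib, ← mul_sum] at hup
  rcases C.eq_empty_or_nonempty with rfl | hne
  · simp only [card_empty, Nat.cast_zero, zero_mul]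
    exact mul_nonneg (by positivity) (sub_nonneg.mpr ht)
  have hCpos : (0 : ℝ) < #C := by exact_mod_cast hne.card_pos
  have hfin : (#C * κ ^ 2) * (#C * (μ - t)) ≤ (#C * κ ^ 2) * (#S * (1 - t)) := by
    calc _ = (#C * κ) ^ 2 * (μ - t) := by ring
      _ ≤ (#S * ∑ x ∈ C, ∑ y ∈ C, K x y ^ 2) * (μ - t) :=
        mul_le_mul_of_nonneg_right htr (sub_nonneg.mpr hμ)
      _ = #S * ((μ - t) * ∑ x ∈ C, ∑ y ∈ C, K x y ^ 2) := by ring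
      _ ≤ #S * (#C * ((1 - t) * κ ^ 2)) := by
        refine mul_le_mul_of_nonneg_left ?_ (by positivity)
        linarith
      _ = _ := by ring
  exact le_of_mul_le_mul_left hfin (by positivity)

theorem sum_sin_mul_add (A : ℕ → ℝ) (θ : ℝ) (m : ℕ) :
    ∑ r ∈ range m, Real.sin ((r + 1) * θ) * (A (r + 2) + A r) =
      2 * Real.cos θ * ∑ r ∈ range m, Real.sin ((r + 1) * θ) * A (r + 1) +
        Real.sin (m * θ) * A (m + 1) + Real.sin θ * A 0 - Real.sin ((m + 1) * θ) * A m := by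
  induction m with
  | zero => simp
  | succ m ih =>
    have h1 : Real.sin (m * θ) =
        Real.sin ((m + 1) * θ) * Real.cos θ - Real.cos ((m + 1) * θ) * Real.sin θ := by
      rw [← Real.sin_sub]
      ring_nf
    have h2 : Real.sin ((m + 1 + 1) * θ) =
        Real.sin ((m + 1) * θ) * Real.cos θ + Real.cos ((m + 1) * θ) * Real.sin θ := by
      rw [← Real.sin_add]
      ring_nf
    rw [sum_range_succ, sum_range_succ, ih]
    push_cast
    rw [h2]
    linear_combination A (m + 1) * h1

variable {n : ℕ}

/-- The coefficient of the Gegenbauer polynomial of degree `i + 1` in `s` times that of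
degree `i`. -/
noncomputable def upCoeff (n i : ℕ) : ℝ := (i + n - 2) / (2 * i + n - 2)

/-- The coefficient of the Gegenbauer polynomial of degree `i - 1` in `s` times that of
degree `i`. -/
noncomputable def downCoeff (n i : ℕ) : ℝ := i / (2 * i + n - 2)

theorem upCoeff_pos (hn : 3 ≤ n) (i : ℕ) : 0 < upCoeff n i := by
  have h : (3 : ℝ) ≤ n := by exact_mod_cast hn
  have h' : (0 : ℝ) ≤ i := by positivity
  exact div_pos (by linarith) (by linarith)

theorem downCoeff_pos (hn : 3 ≤ n) (i : ℕ) : 0 < downCoeff n (i + 1) := by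
  have h : (3 : ℝ) ≤ n := by exact_mod_cast hn
  have h' : (0 : ℝ) ≤ i := by positivity
  refine div_pos (by positivity) ?_
  push_cast
  linarith

theorem mul_gegenbauer (hn : 3 ≤ n) (i : ℕ) (s : ℝ) :
    s * gegenbauer n (i + 1) s = upCoeff n (i + 1) * gegenbauer n (i + 2) s +
      downCoeff n (i + 1) * gegenbauer n i s := by
  have h : (3 : ℝ) ≤ n := by exact_mod_cast hn
  have h' : (0 : ℝ) ≤ i := by positivity
  have h1 : (i + n - 1 : ℝ) ≠ 0 := by linarith
  have h2 : (2 * (i + 1) + n - 2 : ℝ) ≠ 0 := by linarith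
  have h3 : (i + 1 + n - 2 : ℝ) = i + n - 1 := by ring
  have h4 : (2 * i + n : ℝ) = 2 * (i + 1) + n - 2 := by ring
  rw [gegenbauer, upCoeff, downCoeff]
  push_cast
  rw [h3, h4]
  field_simp
  ring

theorem gegenbauer_one (hn : 3 ≤ n) : ∀ i, gegenbauer n i 1 = 1
  | 0 => rfl
  | 1 => rfl
  | i + 2 => by
    have h : (3 : ℝ) ≤ n := by exact_mod_cast hn
    have h' : (0 : ℝ) ≤ i := by positivity
    have h1 : (i + n - 1 : ℝ) ≠ 0 := by linarith
    rw [gegenbauer, gegenbauer_one hn (i + 1), gegenbauer_one hn i]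
    field_simp
    ring

/-- Rescaling by these factors makes the three-term recursion symmetric. -/
noncomputable def symmScale (n j : ℕ) : ℝ :=
  ∏ i ∈ range j, √(upCoeff n i / downCoeff n (i + 1))

theorem symmScale_pos (hn : 3 ≤ n) (j : ℕ) : 0 < symmScale n j :=
  prod_pos fun i _ => Real.sqrt_pos.mpr (div_pos (upCoeff_pos hn i) (downCoeff_pos hn i))

theorem mul_symmScale_succ_le (hn : 3 ≤ n) {τ : ℝ} {j : ℕ}
    (h : τ ^ 2 ≤ upCoeff n j * downCoeff n (j + 1)) :
    τ * symmScale n (j + 1) ≤ symmScale n j * upCoeff n j := by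
  have ha := upCoeff_pos hn j
  have hb := downCoeff_pos hn j
  rw [symmScale, prod_range_succ, ← symmScale, mul_left_comm]
  refine mul_le_mul_of_nonneg_left ?_ (symmScale_pos hn j).le
  refine le_trans (mul_le_mul_of_nonneg_right (Real.le_sqrt_of_sq_le h) (Real.sqrt_nonneg _)) ?_
  rw [← Real.sqrt_mul (mul_pos ha hb).le, show upCoeff n j * downCoeff n (j + 1) *
    (upCoeff n j / downCoeff n (j + 1)) = upCoeff n j ^ 2 by field_simp, Real.sqrt_sq ha.le]

theorem mul_symmScale_le (hn : 3 ≤ n) {τ : ℝ} {j : ℕ}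
    (h : τ ^ 2 ≤ upCoeff n j * downCoeff n (j + 1)) :
    τ * symmScale n j ≤ symmScale n (j + 1) * downCoeff n (j + 1) := by
  have ha := upCoeff_pos hn j
  have hb := downCoeff_pos hn j
  rw [symmScale, symmScale, prod_range_succ, ← symmScale, mul_comm τ, mul_assoc]
  refine mul_le_mul_of_nonneg_left ?_ (symmScale_pos hn j).le
  refine (Real.le_sqrt_of_sq_le h).trans_eq ?_
  rw [← Real.sqrt_sq hb.le, ← Real.sqrt_mul (div_pos ha (by rwa [Real.sqrt_sq hb.le])).le,
    Real.sqrt_sq hb.le]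
  congr 1
  field_simp

open RealInnerProductSpace in
/-- The linear programming bound with a window of Gegenbauer polynomials weighted by a sine. -/
theorem card_mul_le (hn : 3 ≤ n) {t τ : ℝ} (ht : t ≤ 1) (hτ : 0 ≤ τ) {l m : ℕ} (hm : 0 < m)
    (hl : ∀ j, l ≤ j → τ ^ 2 ≤ upCoeff n j * downCoeff n (j + 1))
    (hμ : t < 2 * τ * Real.cos (Real.pi / (m + 1)))
    (C : Finset (EuclideanSpace ℝ (Fin n))) (hC : ∀ x ∈ C, ‖x‖ = 1)
    (hCt : ∀ x ∈ C, ∀ y ∈ C, x ≠ y → ⟪x, y⟫ ≤ t) :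
    (#C : ℝ) * (2 * τ * Real.cos (Real.pi / (m + 1)) - t) ≤
      (∑ r ∈ range m, (n + (l + r)).choose (l + r + 1) : ℕ) * (1 - t) := by
  set θ : ℝ := Real.pi / (m + 1) with hθ
  have hθπ : ((m : ℝ) + 1) * θ = Real.pi := by rw [hθ]; field_simp
  have hθ0 : 0 < θ := by positivity
  have hsin : ∀ r : ℕ, r ≤ m → 0 ≤ Real.sin (r * θ) := fun r hr => by
    refine Real.sin_nonneg_of_nonneg_of_le_pi (by positivity) ?_
    rw [← hθπ]
    gcongr
    have : (r : ℝ) ≤ m := by exact_mod_cast hr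
    linarith
  have hsin' : ∀ r ∈ range m, 0 ≤ Real.sin ((r + 1) * θ) := fun r hr => by
    have := hsin (r + 1) (by simpa [Nat.succ_le_iff] using hr)
    push_cast at this
    exact this
  have hinner : ∀ x y : EuclideanSpace ℝ (Fin n), ∑ j, x j * y j = ⟪x, y⟫ := fun x y => by
    simp [PiLp.inner_apply, mul_comm]
  have hself : ∀ x ∈ C, ⟪x, x⟫ = 1 := fun x hx => by
    rw [real_inner_self_eq_norm_sq, hC x hx, one_pow]
  choose w hw using fun i => exists_gegenbauer_eq_sum (n := n) (by omega) i
  set c : ℕ → ℝ := fun r => Real.sin ((r + 1) * θ) * symmScale n (l + r + 1) with hc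
  have hc0 : ∀ r ∈ range m, 0 ≤ c r := fun r hr =>
    mul_nonneg (hsin' r hr) (symmScale_pos hn _).le
  set P : ℕ → EuclideanSpace ℝ (Fin n) → EuclideanSpace ℝ (Fin n) → ℝ :=
    fun i x y => gegenbauer n i ⟪x, y⟫ with hP
  have hPw : ∀ i, ∀ x ∈ C, ∀ y ∈ C, P i x y =
      ∑ a ∈ univ.finsuppAntidiag i, w i x a * w i y a := fun i x hx y hy => by
    rw [hP, ← hw i x y (by rw [hinner, hself x hx]) (by rw [hinner, hself y hy]), hinner]
  set K : EuclideanSpace ℝ (Fin n) → EuclideanSpace ℝ (Fin n) → ℝ :=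
    fun x y => ∑ r ∈ range m, c r * P (l + r + 1) x y with hK
  set S := (range m).sigma fun r => (univ : Finset (Fin n)).finsuppAntidiag (l + r + 1) with hS
  set u : (Σ _ : ℕ, Fin n →₀ ℕ) → EuclideanSpace ℝ (Fin n) → ℝ :=
    fun a x => √(c a.1) * w (l + a.1 + 1) x a.2 with hu
  have hKu : ∀ x ∈ C, ∀ y ∈ C, K x y = ∑ a ∈ S, u a x * u a y := fun x hx y hy => by
    rw [hS, sum_sigma]
    refine sum_congr rfl fun r hr => ?_
    rw [hPw _ x hx y hy, mul_sum]
    refine sum_congr rfl fun a _ => ?_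
    simp only [hu]
    linear_combination -(w (l + r + 1) x a * w (l + r + 1) y a) * Real.mul_self_sqrt (hc0 r hr)
  have hcard : #S = ∑ r ∈ range m, (n + (l + r)).choose (l + r + 1) := by
    rw [hS, card_sigma]
    refine sum_congr rfl fun r _ => ?_
    rw [card_finsuppAntidiag_nat_eq_choose, card_univ, Fintype.card_fin]
    congr 1
  set κ : ℝ := ∑ r ∈ range m, c r with hκ
  have hKself : ∀ x ∈ C, K x x = κ := fun x hx => by
    simp only [hK, hP, hself x hx, gegenbauer_one hn, mul_one, hκ]
  have hκ0 : 0 < κ := by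
    refine sum_pos' hc0 ⟨0, by simpa using hm, mul_pos ?_ (symmScale_pos hn _)⟩
    have : (0 : ℝ) < m := by exact_mod_cast hm
    refine Real.sin_pos_of_pos_of_lt_pi (by simpa using hθ0) ?_
    rw [← hθπ]
    gcongr
  set B : ℕ → ℝ := fun i => ∑ x ∈ C, ∑ y ∈ C, K x y * P i x y with hB
  have hB0 : ∀ i, 0 ≤ B i := fun i => by
    have : B i = ∑ x ∈ C, ∑ y ∈ C, (∑ a ∈ S, u a x * u a y) *
        ∑ a ∈ univ.finsuppAntidiag i, w i x a * w i y a :=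
      sum_congr rfl fun x hx => sum_congr rfl fun y hy => by rw [hKu x hx y hy, hPw i x hx y hy]
    rw [this, sum_gram_mul_gram_eq C S _ u fun a x => w i x a]
    positivity
  set A : ℕ → ℝ := fun r => symmScale n (l + r) * B (l + r) with hA
  have hA0 : ∀ r, 0 ≤ A r := fun r => mul_nonneg (symmScale_pos hn _).le (hB0 _)
  have hKK : ∑ x ∈ C, ∑ y ∈ C, K x y ^ 2 =
      ∑ r ∈ range m, Real.sin ((r + 1) * θ) * A (r + 1) := by
    have h : ∀ x y, K x y ^ 2 = ∑ r ∈ range m, c r * (K x y * P (l + r + 1) x y) := fun x y => by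
      rw [sq]
      conv_lhs => enter [2]; rw [hK]
      rw [mul_sum]
      exact sum_congr rfl fun r _ => by ring
    simp only [h]
    rw [sum_congr rfl fun x _ => sum_comm, sum_comm]
    refine sum_congr rfl fun r _ => ?_
    simp only [← mul_sum, hc, hA, hB, mul_assoc, add_assoc]
  have hsKK : ∑ x ∈ C, ∑ y ∈ C, ⟪x, y⟫ * K x y ^ 2 =
      ∑ r ∈ range m, c r * (upCoeff n (l + r + 1) * B (l + r + 2) +
        downCoeff n (l + r + 1) * B (l + r)) := by
    have h : ∀ x y, ⟪x, y⟫ * K x y ^ 2 = ∑ r ∈ range m, c r *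
        (upCoeff n (l + r + 1) * (K x y * P (l + r + 2) x y) +
          downCoeff n (l + r + 1) * (K x y * P (l + r) x y)) := fun x y => by
      rw [sq, mul_left_comm]
      conv_lhs => enter [2]; rw [hK]
      rw [mul_sum, mul_sum]
      refine sum_congr rfl fun r _ => ?_
      linear_combination K x y * c r * mul_gegenbauer hn (l + r) ⟪x, y⟫
    simp only [h]
    rw [sum_congr rfl fun x _ => sum_comm, sum_comm]
    refine sum_congr rfl fun r _ => ?_
    simp only [← mul_sum, sum_add_distrib, hB]
  have hlow : 2 * τ * Real.cos θ * ∑ x ∈ C, ∑ y ∈ C, K x y ^ 2 ≤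
      ∑ x ∈ C, ∑ y ∈ C, ⟪x, y⟫ * K x y ^ 2 := by
    rw [hsKK, hKK]
    have h1 := sum_sin_mul_add A θ m
    rw [hθπ, Real.sin_pi] at h1
    have h2 : 0 ≤ Real.sin (m * θ) * A (m + 1) + Real.sin θ * A 0 :=
      add_nonneg (mul_nonneg (hsin m le_rfl) (hA0 _))
        (mul_nonneg (by simpa using hsin 1 hm) (hA0 _))
    have h3 : ∑ r ∈ range m, τ * (Real.sin ((r + 1) * θ) * (A (r + 2) + A r)) ≤
        ∑ r ∈ range m, c r * (upCoeff n (l + r + 1) * B (l + r + 2) +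
          downCoeff n (l + r + 1) * B (l + r)) := by
      refine sum_le_sum fun r hr => ?_
      have h4 := mul_le_mul_of_nonneg_right
        (mul_symmScale_succ_le hn (hl (l + r + 1) (by omega))) (hB0 (l + r + 2))
      have h5 := mul_le_mul_of_nonneg_right
        (mul_symmScale_le hn (hl (l + r) (by omega))) (hB0 (l + r))
      have h6 := mul_le_mul_of_nonneg_left (add_le_add h4 h5) (hsin' r hr)
      simp only [hc, hA, ← add_assoc] at h6 ⊢
      linarith
    rw [← mul_sum, h1] at h3
    nlinarith [mul_nonneg hτ h2]
  have h := card_mul_le_of_gram hκ0 (fun x y => ⟪x, y⟫) u ht hμ.le hKu hKself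
    (fun x hx => (hself x hx).le) hCt hlow
  rwa [hcard] at h

theorem le_upCoeff_mul_downCoeff (hn : 3 ≤ n) {R : ℝ} (hR : 1 ≤ R) {j : ℕ}
    (hj : R * n ≤ 2 * j + n) :
    (1 - 1 / R ^ 2) / 4 ≤ upCoeff n j * downCoeff n (j + 1) := by
  have h : (3 : ℝ) ≤ n := by exact_mod_cast hn
  have h' : (0 : ℝ) ≤ j := by positivity
  rw [upCoeff, downCoeff, div_mul_div_comm, show 1 - 1 / R ^ 2 = (R ^ 2 - 1) / R ^ 2 by field_simp,
    div_div]
  push_cast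
  rw [div_le_div_iff₀ (by positivity) (mul_pos (by linarith) (by linarith))]
  have h1 : R * (n - 3) ≤ 2 * j + n - 1 := by linarith
  have h2 : (R * (n - 3)) ^ 2 ≤ (2 * j + n - 1) ^ 2 :=
    pow_le_pow_left₀ (mul_nonneg (by linarith) (by linarith)) h1 2
  nlinarith

theorem choose_mul_pow_le {ρ : ℝ} (hρ : 0 ≤ ρ) (N i : ℕ) : N.choose i * ρ ^ i ≤ (1 + ρ) ^ N := by
  rcases lt_or_ge N i with h | h
  · rw [Nat.choose_eq_zero_of_lt h]
    simp only [Nat.cast_zero, zero_mul]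
    positivity
  rw [add_comm, add_pow]
  refine le_trans ?_ (single_le_sum (f := fun k => ρ ^ k * 1 ^ (N - k) * (N.choose k : ℝ))
    (fun k _ => by positivity) (mem_range.mpr (Nat.lt_succ_of_le h)))
  simp [mul_comm]

theorem sum_choose_le {ρ : ℝ} (hρ : 0 < ρ) (n l m : ℕ) :
    ((∑ r ∈ range m, (n + (l + r)).choose (l + r + 1) : ℕ) : ℝ) ≤
      m * ((1 + ρ) ^ n * ((1 + ρ) / ρ) ^ (l + m)) := by
  push_cast
  refine (sum_le_card_nsmul _ _ ((1 + ρ) ^ n * ((1 + ρ) / ρ) ^ (l + m)) fun r hr => ?_).trans_eq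
    (by rw [card_range, nsmul_eq_mul])
  have h1 : 1 ≤ (1 + ρ) / ρ := by rw [le_div_iff₀ hρ]; linarith
  calc ((n + (l + r)).choose (l + r + 1) : ℝ)
      ≤ (1 + ρ) ^ (n + (l + r)) / ρ ^ (l + r + 1) := by
        rw [le_div_iff₀ (by positivity)]
        exact choose_mul_pow_le hρ.le _ _
    _ ≤ (1 + ρ) ^ (n + (l + r + 1)) / ρ ^ (l + r + 1) := by
        gcongr ?_ / _
        exact pow_le_pow_right₀ (by linarith) (by omega)
    _ = (1 + ρ) ^ n * ((1 + ρ) / ρ) ^ (l + r + 1) := by rw [pow_add, div_pow, mul_div_assoc]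
    _ ≤ _ := by
        have := mem_range.mp hr
        gcongr (1 + ρ) ^ n * ?_
        exact pow_le_pow_right₀ h1 (by omega)

end SphericalCode

open RealInnerProductSpace

/-- The asymptotic Kabatiansky–Levenshtein bound for spherical codes. -/
theorem kl_bound_spherical (t : ℝ) (ht0 : 0 < t) (ht1 : t < 1)
    (ρ : ℝ) (hρ : ρ = (1 - Real.sqrt (1 - t ^ 2)) / (2 * Real.sqrt (1 - t ^ 2)))
    (ε : ℝ) (hε : 0 < ε) :
    ∃ N : ℕ, ∀ n : ℕ, N ≤ n → ∀ C : Finset (EuclideanSpace ℝ (Fin n)),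
      (∀ x ∈ C, ‖x‖ = 1) →
      (∀ x ∈ C, ∀ y ∈ C, x ≠ y → ⟪x, y⟫ ≤ t) →
      (1 / (n : ℝ)) * Real.logb 2 C.card
        ≤ (1 + ρ) * Real.logb 2 (1 + ρ) - ρ * Real.logb 2 ρ + ε := by
  have ht2 : 0 < 1 - t ^ 2 := by nlinarith
  have hs0 : 0 < √(1 - t ^ 2) := Real.sqrt_pos.mpr ht2
  have hs1 : √(1 - t ^ 2) < 1 := by
    rw [Real.sqrt_lt' one_pos]
    nlinarith
  have hρ0 : 0 < ρ := by
    rw [hρ]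
    exact div_pos (by linarith) (by linarith)
  have hRt : 1 - 1 / (1 + 2 * ρ) ^ 2 = t ^ 2 := by
    have : 1 + 2 * ρ = 1 / √(1 - t ^ 2) := by
      rw [hρ]
      field_simp
      ring
    rw [this, div_pow, Real.sq_sqrt ht2.le]
    field_simp
    ring
  set q : ℝ := (1 + ρ) / ρ with hq
  have hq1 : 1 < q := by
    rw [hq, lt_div_iff₀ hρ0]
    linarith
  have hL : 0 < Real.logb 2 q := Real.logb_pos one_lt_two hq1
  set η : ℝ := ε / (2 * Real.logb 2 q) with hη
  have hη0 : 0 < η := by positivity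
  set R : ℝ := 1 + 2 * (ρ + η) with hR
  have hR1 : 1 < R := by linarith
  have htR : t ^ 2 < 1 - 1 / R ^ 2 := by
    rw [← hRt]
    gcongr
    linarith
  set τ : ℝ := √(1 - 1 / R ^ 2) / 2 with hτ
  have htτ : t < 2 * τ := by
    rw [hτ, mul_div_cancel₀ _ two_ne_zero]
    exact Real.lt_sqrt_of_sq_lt htR
  have hlim : Filter.Tendsto (fun m : ℕ => 2 * τ * Real.cos (Real.pi / ((m : ℝ) + 1)))
      Filter.atTop (nhds (2 * τ)) := by
    have h1 : Filter.Tendsto (fun m : ℕ => Real.pi / ((m : ℝ) + 1)) Filter.atTop (nhds 0) :=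
      tendsto_const_nhds.div_atTop
        (Filter.tendsto_atTop_add_const_right _ _ tendsto_natCast_atTop_atTop)
    simpa using (Real.continuous_cos.continuousAt.tendsto.comp h1).const_mul (2 * τ)
  obtain ⟨m, hmt, hm⟩ :=
    ((hlim.eventually (lt_mem_nhds htτ)).and (Filter.eventually_gt_atTop 0)).exists
  set δ : ℝ := 2 * τ * Real.cos (Real.pi / ((m : ℝ) + 1)) - t with hδ
  have hδ0 : 0 < δ := sub_pos.mpr hmt
  have hm0 : (0 : ℝ) < m := by exact_mod_cast hm
  set M : ℝ := Real.logb 2 (m * (1 - t) / δ) + (1 + m) * Real.logb 2 q with hM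
  obtain ⟨N, hN⟩ := exists_nat_ge (M / (ε / 2))
  refine ⟨max N 3, fun n hn C hC hCt => ?_⟩
  have hn3 : 3 ≤ n := (le_max_right _ _).trans hn
  have hn0 : (0 : ℝ) < n := by exact_mod_cast (by omega : 0 < n)
  have hMn : M ≤ ε / 2 * n := by
    rw [← div_le_iff₀' (by positivity)]
    exact hN.trans (by exact_mod_cast (le_max_left _ _).trans hn)
  set l : ℕ := ⌈(ρ + η) * n⌉₊ with hl
  have hl1 : (ρ + η) * n ≤ l := Nat.le_ceil _
  have hl2 : (l : ℝ) ≤ (ρ + η) * n + 1 := (Nat.ceil_lt_add_one (by positivity)).le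
  have hbound := SphericalCode.card_mul_le hn3 ht1.le (τ := τ) (by positivity) (l := l) hm
    (fun j hj => by
      have hj' : (l : ℝ) ≤ j := by exact_mod_cast hj
      have h1 : R * n ≤ 2 * j + n := by
        rw [hR]
        linarith
      refine le_trans (le_of_eq ?_) (SphericalCode.le_upCoeff_mul_downCoeff hn3 hR1.le h1)
      rw [hτ, div_pow, Real.sq_sqrt ((sq_nonneg t).trans htR.le)]
      norm_num) hmt C hC hCt
  have hexp : (1 + ρ) * Real.logb 2 (1 + ρ) - ρ * Real.logb 2 ρ =
      Real.logb 2 (1 + ρ) + ρ * Real.logb 2 q := by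
    rw [hq, Real.logb_div (by linarith) hρ0.ne']
    ring
  have h1t : 0 < 1 - t := sub_pos.mpr ht1
  have hρ1 : 1 ≤ 1 + ρ := by linarith
  rw [hexp]
  rcases C.eq_empty_or_nonempty with rfl | hne
  · have : 0 ≤ Real.logb 2 (1 + ρ) := Real.logb_nonneg one_lt_two hρ1
    simp only [Finset.card_empty, Nat.cast_zero, Real.logb_zero, mul_zero]
    positivity
  have hcard : (0 : ℝ) < C.card := by exact_mod_cast hne.card_pos
  have hle : (C.card : ℝ) ≤ m * (1 - t) / δ * ((1 + ρ) ^ n * q ^ (l + m)) := by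
    rw [div_mul_eq_mul_div, le_div_iff₀ hδ0]
    refine hbound.trans ?_
    refine (mul_le_mul_of_nonneg_right (SphericalCode.sum_choose_le hρ0 n l m) h1t.le).trans_eq ?_
    ring
  have hlog := Real.logb_le_logb_of_le one_lt_two hcard hle
  rw [Real.logb_mul (by positivity) (by positivity), Real.logb_mul (by positivity) (by positivity),
    Real.logb_pow, Real.logb_pow] at hlog
  have hηL : η * Real.logb 2 q = ε / 2 := by
    rw [hη]
    field_simp
  have hlL : ((l + m : ℕ) : ℝ) * Real.logb 2 q ≤
      ((ρ + η) * n + 1 + m) * Real.logb 2 q := by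
    push_cast
    gcongr
  rw [one_div_mul_eq_div, div_le_iff₀ hn0]
  linear_combination hlog + hlL + hMn + n * hηL
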